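/- Assume in addition ∑_{k≥1} k²·p_k < ∞, ∑_{k≥1} k(k−2)·p_k > 0, and T ≥ μ/2. Let G_0(z) := ∑_{k≥1} p_k·z^k and G_1(z) := ∑_{k≥1} (k·p_k/μ)·z^{k−1} for z ∈ [0,1]. Let ρ ∈ [0,1) satisfy G_1(ρ) = ρ, with ρ := 0 in case p_1 = 0 and ρ ∈ (0,1) in case p_1 > 0. Set τ := (μ/2)(1 − ρ²) > 0. For s ∈ (0,1] let F_s(t) := G_0(s) − G_0(s·t) for t ∈ [0,1], a strictly decreasing continuous bijection from [0,1] onto [0, G_0(s)], let f_s(t) := F_s^{−1}(t) for 0 ≤ t ≤ G_0(s) and f_s(t) := 0 for t > G_0(s), and let f_0(t) := 0 for all t ≥ 0. Define ζ_0(t) := [μ − 2t − μ·√(1 − 2t/μ)·G_1(√(1 − 2t/μ))]·1_{[0,τ]}(t); ζ_k(t) := p_k·(1 − 2t/μ)^{k/2} for 0 ≤ t ≤ τ and ζ_k(t) := p_k·ρ^k·(f_ρ(t − τ))^k for t > τ, for k ≥ 1; and ψ(t) := −2·∫_0^t r_0(ζ(s)) ds + ∑_{k≥1} (k−2)·(p_k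 − ζ_k(t)). Then (ζ, ψ) ∈ C_T and I_T(ζ, ψ) = 0. -/

import Mathlib

open MeasureTheory Filter Topology
open scoped ENNReal

noncomputable def ell (x : ℝ) : ℝ := x * Real.log x - x + 1

noncomputable def rtot (x : ℕ → ℝ) : ℝ := max (x 0) 0 + ∑' k : ℕ, (k : ℝ) * x k

noncomputable def rcoord (x : ℕ → ℝ) (k : ℕ) : ℝ :=
  if 0 < rtot x then (if k = 0 then max (x 0) 0 else (k : ℝ) * x k) / rtot x else 0

noncomputable def skorokhod (ψ : ℝ → ℝ) (t : ℝ) : ℝ :=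
  ψ t - min (sInf (ψ '' Set.Icc 0 t)) 0

def AbsCont (f : ℝ → ℝ) (a b : ℝ) : Prop :=
  ∀ ε > 0, ∃ δ > 0, ∀ n : ℕ, ∀ I : Fin n → ℝ × ℝ,
    (∀ i, (I i).1 ∈ Set.Icc a b ∧ (I i).2 ∈ Set.Icc a b ∧ (I i).1 ≤ (I i).2) →
    (∀ i j, i ≠ j → Disjoint (Set.Ioo (I i).1 (I i).2) (Set.Ioo (I j).1 (I j).2)) →
    (∑ i, ((I i).2 - (I i).1)) < δ →
    (∑ i, |f (I i).2 - f (I i).1|) < ε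

def memCT (T : ℝ) (p : ℕ → ℝ) (ζ : ℕ → ℝ → ℝ) (ψ : ℝ → ℝ) : Prop :=
  (∀ k, ContinuousOn (ζ k) (Set.Icc 0 T)) ∧
  ContinuousOn ψ (Set.Icc 0 T) ∧
  ψ 0 = 0 ∧ AbsCont ψ 0 T ∧
  (∀ t ∈ Set.Icc (0:ℝ) T, ζ 0 t = skorokhod ψ t) ∧
  (∀ k : ℕ, 1 ≤ k →
    ζ k 0 = p k ∧ (∀ t ∈ Set.Icc (0:ℝ) T, 0 ≤ ζ k t) ∧
    AntitoneOn (ζ k) (Set.Icc 0 T) ∧ AbsCont (ζ k) 0 T)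

noncomputable def Bint (ζ : ℕ → ℝ → ℝ) (φ : ℕ → ℝ → ℝ → ℝ) (k : ℕ) (t : ℝ) : ℝ :=
  ∫ q in (Set.Icc (0:ℝ) t) ×ˢ (Set.Icc (0:ℝ) 1),
    (if 0 ≤ q.2 ∧ q.2 < rcoord (fun j => ζ j q.1) k then φ k q.1 q.2 else 0)

def memST (T : ℝ) (p : ℕ → ℝ) (ζ : ℕ → ℝ → ℝ) (ψ : ℝ → ℝ) (φ : ℕ → ℝ → ℝ → ℝ) : Prop :=
  (∀ k, Measurable (fun q : ℝ × ℝ => φ k q.1 q.2)) ∧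
  (∀ k s y, 0 ≤ φ k s y) ∧
  (∀ k, IntegrableOn
      (fun q : ℝ × ℝ => if 0 ≤ q.2 ∧ q.2 < rcoord (fun j => ζ j q.1) k then φ k q.1 q.2 else 0)
      ((Set.Icc (0:ℝ) T) ×ˢ (Set.Icc (0:ℝ) 1))) ∧
  (∀ t ∈ Set.Icc (0:ℝ) T, ψ t = ∑' k : ℕ, ((k : ℝ) - 2) * Bint ζ φ k t) ∧
  (∀ t ∈ Set.Icc (0:ℝ) T, ∀ k : ℕ, 1 ≤ k → ζ k t = p k - Bint ζ φ k t)

noncomputable def costE (T : ℝ) (φ : ℕ → ℝ → ℝ → ℝ) : ℝ≥0∞ :=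
  ∑' k : ℕ, ∫⁻ q in (Set.Icc (0:ℝ) T) ×ˢ (Set.Icc (0:ℝ) 1),
    ENNReal.ofReal (ell (φ k q.1 q.2))

open Classical in
noncomputable def rateI (T : ℝ) (p : ℕ → ℝ) (ζ : ℕ → ℝ → ℝ) (ψ : ℝ → ℝ) : ℝ≥0∞ :=
  if memCT T p ζ ψ then ⨅ (φ : ℕ → ℝ → ℝ → ℝ) (_ : memST T p ζ ψ φ), costE T φ else ⊤


/-- The generating function of the sequence `p`. -/
noncomputable def pgf (p : ℕ → ℝ) (x : ℝ) : ℝ := ∑' k : ℕ, p k * x ^ k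

/-- The termwise derivative of `pgf p`. -/
noncomputable def pgfDeriv (p : ℕ → ℝ) (x : ℝ) : ℝ := ∑' k : ℕ, (k : ℝ) * p k * x ^ (k - 1)

lemma summable_mul_pow {a : ℕ → ℝ} (ha : ∀ k, 0 ≤ a k) (hs : Summable a) {x : ℝ}
    (hx : x ∈ Set.Icc (0 : ℝ) 1) (e : ℕ → ℕ) : Summable fun k => a k * x ^ e k :=
  Summable.of_nonneg_of_le (fun k => mul_nonneg (ha k) (pow_nonneg hx.1 _))
    (fun k => mul_le_of_le_one_right (ha k) (pow_le_one₀ hx.1 hx.2)) hs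

lemma pgf_nonneg {p : ℕ → ℝ} (hp : ∀ k, 0 ≤ p k) {x : ℝ} (hx : 0 ≤ x) : 0 ≤ pgf p x :=
  tsum_nonneg fun k => mul_nonneg (hp k) (pow_nonneg hx _)

lemma pgf_zero {p : ℕ → ℝ} (hp0 : p 0 = 0) : pgf p 0 = 0 := by
  unfold pgf
  rw [← tsum_zero (α := ℝ) (β := ℕ)]
  refine tsum_congr fun k => ?_
  rcases k with _ | k
  · simp [hp0]
  · simp

lemma pgf_natCast_mul (p : ℕ → ℝ) (x : ℝ) :
    pgf (fun k => (k : ℝ) * p k) x = x * pgfDeriv p x := by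
  unfold pgf pgfDeriv
  rw [← tsum_mul_left]
  refine tsum_congr fun k => ?_
  rcases k with _ | k
  · simp
  · simp only [Nat.add_sub_cancel, pow_succ]; ring

lemma continuousOn_pgf {p : ℕ → ℝ} (hp : ∀ k, 0 ≤ p k) (hs : Summable p) :
    ContinuousOn (pgf p) (Set.Icc 0 1) := by
  refine continuousOn_tsum (fun k => by fun_prop) hs fun k x hx => ?_
  rw [Real.norm_of_nonneg (mul_nonneg (hp k) (pow_nonneg hx.1 _))]
  exact mul_le_of_le_one_right (hp k) (pow_le_one₀ hx.1 hx.2)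

lemma hasDerivAt_pgf {p : ℕ → ℝ} (hp : ∀ k, 0 ≤ p k)
    (hs : Summable p) (hm : Summable fun k : ℕ => (k : ℝ) * p k) {x : ℝ}
    (hx : x ∈ Set.Ico (0 : ℝ) 1) : HasDerivAt (pgf p) (pgfDeriv p x) x := by
  refine hasDerivAt_tsum_of_isPreconnected (t := Set.Ioo (-1 : ℝ) 1) (y₀ := x)
    (g := fun k x => p k * x ^ k) (g' := fun k x => (k : ℝ) * p k * x ^ (k - 1))
    hm isOpen_Ioo isPreconnected_Ioo (fun k y _ => ?_) (fun k y hy => ?_) ?_ ?_ ?_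
  · simpa [mul_comm, mul_assoc, mul_left_comm] using (hasDerivAt_pow k y).const_mul (p k)
  · have h0 : 0 ≤ (k : ℝ) * p k := mul_nonneg k.cast_nonneg (hp k)
    rw [norm_mul, Real.norm_of_nonneg h0, norm_pow]
    refine mul_le_of_le_one_right h0 (pow_le_one₀ (norm_nonneg _) ?_)
    rw [Real.norm_eq_abs, abs_le]; exact ⟨hy.1.le, hy.2.le⟩
  · exact ⟨by linarith [hx.1], hx.2⟩
  · exact summable_mul_pow hp hs ⟨hx.1, hx.2.le⟩ _
  · exact ⟨by linarith [hx.1], hx.2⟩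

/-- The generating function grows at least as fast as its linear term. -/
lemma mul_sub_le_pgf_sub {p : ℕ → ℝ} (hp : ∀ k, 0 ≤ p k) (hs : Summable p) {x y : ℝ}
    (hx : 0 ≤ x) (hxy : x ≤ y) (hy : y ≤ 1) : p 1 * (y - x) ≤ pgf p y - pgf p x := by
  have sy := summable_mul_pow hp hs ⟨hx.trans hxy, hy⟩ (fun k => k)
  have sx := summable_mul_pow hp hs ⟨hx, hxy.trans hy⟩ (fun k => k)
  unfold pgf
  rw [← sy.tsum_sub sx]
  have h := (sy.sub sx).le_tsum 1 fun k _ => by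
    have := mul_le_mul_of_nonneg_left (pow_le_pow_left₀ hx hxy k) (hp k)
    simpa using this
  calc _ = p 1 * y ^ 1 - p 1 * x ^ 1 := by ring
    _ ≤ _ := h

lemma pow_sub_pow_le_mul_sub {u v : ℝ} (hu : 0 ≤ u) (huv : u ≤ v) (n : ℕ) :
    v ^ n - u ^ n ≤ n * v ^ (n - 1) * (v - u) := by
  rw [← mul_comm (v - u), ← (Commute.all v u).mul_geom_sum₂]
  refine mul_le_mul_of_nonneg_left ?_ (sub_nonneg.2 huv)
  calc ∑ i ∈ Finset.range n, v ^ i * u ^ (n - 1 - i)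
      ≤ ∑ i ∈ Finset.range n, v ^ (n - 1) := by
        refine Finset.sum_le_sum fun i hi => ?_
        have hi' := Finset.mem_range.1 hi
        have hv := hu.trans huv
        calc v ^ i * u ^ (n - 1 - i) ≤ v ^ i * v ^ (n - 1 - i) := by gcongr
          _ = v ^ (n - 1) := by rw [← pow_add]; congr 1; omega
    _ = _ := by simp

lemma natCast_mul_pow_mul_le {x : ℝ} (hx : x ∈ Set.Icc (0 : ℝ) 1) (n : ℕ) :
    (n : ℝ) * x ^ n * (1 - x) ≤ x * (1 - x ^ n) := by
  induction n with
  | zero => simp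
  | succ n ih =>
    have h1 := mul_le_mul_of_nonneg_left ih hx.1
    have h2 : 0 ≤ x * (1 - x) * (1 - x ^ n) :=
      mul_nonneg (mul_nonneg hx.1 (sub_nonneg.2 hx.2)) (sub_nonneg.2 (pow_le_one₀ hx.1 hx.2))
    rw [pow_succ]
    push_cast
    linarith

lemma AbsCont.of_lipschitz {f : ℝ → ℝ} {a b C : ℝ}
    (h : ∀ s ∈ Set.Icc a b, ∀ t ∈ Set.Icc a b, s ≤ t → |f t - f s| ≤ C * (t - s)) :
    AbsCont f a b := by
  intro ε hε
  have hC : 0 < |C| + 1 := by positivity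
  refine ⟨ε / (|C| + 1), div_pos hε hC, fun n I hI _ hsum => ?_⟩
  calc ∑ i, |f (I i).2 - f (I i).1| ≤ ∑ i, (|C| + 1) * ((I i).2 - (I i).1) := by
        refine Finset.sum_le_sum fun i _ => (h _ (hI i).1 _ (hI i).2.1 (hI i).2.2).trans ?_
        refine mul_le_mul_of_nonneg_right ?_ (sub_nonneg.2 (hI i).2.2)
        linarith [le_abs_self C]
    _ = (|C| + 1) * ∑ i, ((I i).2 - (I i).1) := by rw [Finset.mul_sum]
    _ < ε := by rw [lt_div_iff₀ hC] at hsum; linarith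

lemma continuousOn_of_lipschitz {f : ℝ → ℝ} {a b C : ℝ}
    (h : ∀ s ∈ Set.Icc a b, ∀ t ∈ Set.Icc a b, s ≤ t → |f t - f s| ≤ C * (t - s)) :
    ContinuousOn f (Set.Icc a b) := by
  refine (LipschitzOnWith.of_dist_le_mul (K := (|C|).toNNReal) fun s hs t ht => ?_).continuousOn
  rw [Real.coe_toNNReal _ (abs_nonneg C), Real.dist_eq, Real.dist_eq]
  rcases le_total s t with hst | hst
  · rw [abs_sub_comm, abs_sub_comm s, abs_of_nonneg (sub_nonneg.2 hst)]
    exact (h s hs t ht hst).trans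
      (mul_le_mul_of_nonneg_right (le_abs_self C) (sub_nonneg.2 hst))
  · rw [abs_of_nonneg (sub_nonneg.2 hst)]
    exact (h t ht s hs hst).trans
      (mul_le_mul_of_nonneg_right (le_abs_self C) (sub_nonneg.2 hst))

lemma integrableOn_ite_lt {r : ℝ → ℝ} (hr : Measurable r) (t : ℝ) :
    IntegrableOn (fun q : ℝ × ℝ => if 0 ≤ q.2 ∧ q.2 < r q.1 then (1 : ℝ) else 0)
      (Set.Icc (0 : ℝ) t ×ˢ Set.Icc (0 : ℝ) 1) := by
  have hm : Measurable (fun q : ℝ × ℝ => if 0 ≤ q.2 ∧ q.2 < r q.1 then (1 : ℝ) else 0) := by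
    refine Measurable.ite ?_ measurable_const measurable_const
    exact (measurableSet_le measurable_const measurable_snd).inter
      (measurableSet_lt measurable_snd (hr.comp measurable_fst))
  refine Measure.integrableOn_of_bounded (M := 1) ?_ hm.aestronglyMeasurable ?_
  · exact (isCompact_Icc.prod isCompact_Icc).measure_lt_top.ne
  · exact Eventually.of_forall fun q => by split_ifs <;> simp

lemma setIntegral_ite_lt {r : ℝ → ℝ} (hr : Measurable r) (h0 : ∀ s, 0 ≤ r s)
    (h1 : ∀ s, r s ≤ 1) {t : ℝ} (ht : 0 ≤ t) :
    ∫ q in Set.Icc (0 : ℝ) t ×ˢ Set.Icc (0 : ℝ) 1,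
      (if 0 ≤ q.2 ∧ q.2 < r q.1 then (1 : ℝ) else 0) = ∫ s in (0 : ℝ)..t, r s := by
  rw [Measure.volume_eq_prod, setIntegral_prod _ (integrableOn_ite_lt hr t),
    integral_Icc_eq_integral_Ioc, intervalIntegral.integral_of_le ht]
  refine integral_congr_ae (Eventually.of_forall fun s => ?_)
  have : (fun y : ℝ => if 0 ≤ y ∧ y < r s then (1 : ℝ) else 0)
      = (Set.Ico 0 (r s)).indicator 1 := by
    ext y; simp [Set.indicator, Set.mem_Ico]
  simp only [this]
  rw [integral_indicator_one measurableSet_Ico, measureReal_restrict_apply measurableSet_Ico,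
    Set.inter_eq_left.2 (Set.Ico_subset_Icc_self.trans (Set.Icc_subset_Icc_right (h1 s)))]
  simp [h0 s]

/-- If the rates `r` are the size-biased frequencies of `ζ` and drive both `ζ` and `ψ`, then the
cost of `(ζ, ψ)` vanishes. -/
lemma rateI_eq_zero_of_integral {T : ℝ} {p : ℕ → ℝ} {ζ : ℕ → ℝ → ℝ} {ψ : ℝ → ℝ}
    {r : ℕ → ℝ → ℝ} (hmem : memCT T p ζ ψ)
    (hr : ∀ k, Measurable (r k)) (h0 : ∀ k s, 0 ≤ r k s) (h1 : ∀ k s, r k s ≤ 1)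
    (hrc : ∀ k, ∀ s, 0 ≤ s → rcoord (fun j => ζ j s) k = r k s)
    (hζ : ∀ k, 1 ≤ k → ∀ t ∈ Set.Icc 0 T, ζ k t = p k - ∫ s in (0 : ℝ)..t, r k s)
    (hψ : ∀ t ∈ Set.Icc 0 T, ψ t = ∑' k : ℕ, ((k : ℝ) - 2) * ∫ s in (0 : ℝ)..t, r k s) :
    rateI T p ζ ψ = 0 := by
  have hcongr : ∀ k t, Set.EqOn
      (fun q : ℝ × ℝ => if 0 ≤ q.2 ∧ q.2 < r k q.1 then (1 : ℝ) else 0)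
      (fun q : ℝ × ℝ => if 0 ≤ q.2 ∧ q.2 < rcoord (fun j => ζ j q.1) k then (1 : ℝ) else 0)
      (Set.Icc (0 : ℝ) t ×ˢ Set.Icc (0 : ℝ) 1) := fun k t q hq => by
    simp only [hrc k q.1 hq.1.1]
  have hmeas : ∀ t : ℝ, MeasurableSet (Set.Icc (0 : ℝ) t ×ˢ Set.Icc (0 : ℝ) 1) :=
    fun t => measurableSet_Icc.prod measurableSet_Icc
  have hB : ∀ k t, 0 ≤ t → Bint ζ (fun _ _ _ => 1) k t = ∫ s in (0 : ℝ)..t, r k s :=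
    fun k t ht => by
      rw [← setIntegral_ite_lt (hr k) (h0 k) (h1 k) ht]
      exact setIntegral_congr_fun (hmeas t) (hcongr k t).symm
  have hST : memST T p ζ ψ fun _ _ _ => 1 := by
    refine ⟨fun _ => measurable_const, fun _ _ _ => zero_le_one, fun k => ?_,
      fun t ht => ?_, fun t ht k hk => ?_⟩
    · exact (integrableOn_ite_lt (hr k) T).congr_fun (hcongr k T) (hmeas T)
    · rw [hψ t ht]; exact tsum_congr fun k => by rw [hB k t ht.1]
    · rw [hB k t ht.1, hζ k hk t ht]
  rw [rateI, if_pos hmem]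
  refine le_antisymm ((iInf₂_le _ hST).trans ?_) zero_le
  simp [costE, ell]

/-- `W` is the edge-survival parameter of the fluid limit: a square root up to time `τ`, and then
the solution of `pgf p (W t) = pgf p ρ - (t - τ)` until it reaches zero. -/
structure FluidProfile (p : ℕ → ℝ) (mu ρ τ : ℝ) (W : ℝ → ℝ) : Prop where
  p_zero : p 0 = 0
  p_nonneg : ∀ k, 0 ≤ p k
  hasSum_p : HasSum p 1
  hasSum_mean : HasSum (fun k : ℕ => (k : ℝ) * p k) mu
  summable_sq : Summable fun k : ℕ => (k : ℝ) ^ 2 * p k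
  mu_pos : 0 < mu
  rho_mem : ρ ∈ Set.Ico (0 : ℝ) 1
  rho_eq_zero : p 1 = 0 → ρ = 0
  rho_pos : 0 < p 1 → 0 < ρ
  fixed : pgfDeriv p ρ = mu * ρ
  tau_eq : τ = mu / 2 * (1 - ρ ^ 2)
  continuous_W : Continuous W
  W_of_le : ∀ t ≤ τ, W t = Real.sqrt (1 - 2 * max t 0 / mu)
  W_mem : ∀ t, τ ≤ t → W t ∈ Set.Icc 0 ρ
  pgf_W : ∀ t, τ ≤ t → pgf p (W t) = max (pgf p ρ - (t - τ)) 0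

/-- The number of active half-edges along the profile `W`. -/
noncomputable def excess (p : ℕ → ℝ) (mu τ : ℝ) (W : ℝ → ℝ) (t : ℝ) : ℝ :=
  if t ≤ τ then mu * W t ^ 2 - W t * pgfDeriv p (W t) else 0

/-- The total number of half-edges along the profile `W`. -/
noncomputable def total (p : ℕ → ℝ) (mu τ : ℝ) (W : ℝ → ℝ) (t : ℝ) : ℝ :=
  if t ≤ τ then mu * W t ^ 2 else W t * pgfDeriv p (W t)

/-- The rate at which half-edges of degree-`k` vertices are selected along the profile `W`. -/
noncomputable def rate (p : ℕ → ℝ) (mu τ : ℝ) (W : ℝ → ℝ) (k : ℕ) (t : ℝ) : ℝ :=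
  (if k = 0 then excess p mu τ W t else (k : ℝ) * p k * W t ^ k) / total p mu τ W t

namespace FluidProfile

variable {p : ℕ → ℝ} {mu ρ τ : ℝ} {W : ℝ → ℝ}

lemma mul_p_nonneg (h : FluidProfile p mu ρ τ W) (k : ℕ) : 0 ≤ (k : ℝ) * p k :=
  mul_nonneg k.cast_nonneg (h.p_nonneg k)

lemma summable_deriv (h : FluidProfile p mu ρ τ W) {x : ℝ} (hx : x ∈ Set.Icc (0 : ℝ) 1) :
    Summable fun k : ℕ => (k : ℝ) * p k * x ^ (k - 1) :=
  summable_mul_pow h.mul_p_nonneg h.hasSum_mean.summable hx fun k => k - 1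

lemma summable_size (h : FluidProfile p mu ρ τ W) {x : ℝ} (hx : x ∈ Set.Icc (0 : ℝ) 1) :
    Summable fun k : ℕ => (k : ℝ) * p k * x ^ k :=
  summable_mul_pow h.mul_p_nonneg h.hasSum_mean.summable hx fun k => k

lemma pgfDeriv_nonneg (h : FluidProfile p mu ρ τ W) {x : ℝ} (hx : 0 ≤ x) : 0 ≤ pgfDeriv p x :=
  tsum_nonneg fun k => mul_nonneg (h.mul_p_nonneg k) (pow_nonneg hx _)

lemma p_one_le_pgfDeriv (h : FluidProfile p mu ρ τ W) {x : ℝ} (hx : x ∈ Set.Icc (0 : ℝ) 1) :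
    p 1 ≤ pgfDeriv p x := by
  have := (h.summable_deriv hx).le_tsum 1 fun k _ =>
    mul_nonneg (h.mul_p_nonneg k) (pow_nonneg hx.1 _)
  simpa [pgfDeriv] using this

lemma mul_pow_le_size (h : FluidProfile p mu ρ τ W) {x : ℝ} (hx : x ∈ Set.Icc (0 : ℝ) 1)
    (k : ℕ) : (k : ℝ) * p k * x ^ k ≤ x * pgfDeriv p x := by
  rw [← pgf_natCast_mul]
  exact (h.summable_size hx).le_tsum k fun k _ =>
    mul_nonneg (h.mul_p_nonneg k) (pow_nonneg hx.1 _)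

/-- Between the fixed points `ρ` and `1` the convex function `G₁` lies below the diagonal. -/
lemma pgfDeriv_le (h : FluidProfile p mu ρ τ W) {x : ℝ} (hx : x ∈ Set.Icc ρ 1) :
    pgfDeriv p x ≤ mu * x := by
  have hρ := h.rho_mem
  have h1ρ : 0 < 1 - ρ := sub_pos.2 hρ.2
  set a := (1 - x) / (1 - ρ) with ha
  have ha0 : 0 ≤ a := div_nonneg (sub_nonneg.2 hx.2) h1ρ.le
  have ha1 : 0 ≤ 1 - a := by
    rw [sub_nonneg, ha, div_le_one h1ρ]; linarith [hx.1]
  have hax : a * ρ + (1 - a) * 1 = x := by rw [ha]; field_simp; ring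
  have hs := (h.summable_deriv ⟨hρ.1, hρ.2.le⟩).hasSum
  have hs' := (hs.mul_left a).add (h.hasSum_mean.mul_left (1 - a))
  have key : pgfDeriv p x ≤ a * pgfDeriv p ρ + (1 - a) * mu := by
    refine hasSum_le (fun k => ?_) (h.summable_deriv ⟨hρ.1.trans hx.1, hx.2⟩).hasSum hs'
    have hc := (convexOn_pow (𝕜 := ℝ) (k - 1)).2 (x := ρ) (y := 1) hρ.1 (Set.mem_Ici.2 zero_le_one) ha0 ha1
      (by ring)
    simp only [smul_eq_mul, one_pow] at hc
    rw [hax] at hc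
    have := mul_le_mul_of_nonneg_left hc (h.mul_p_nonneg k)
    linarith
  rw [h.fixed] at key
  calc _ ≤ _ := key
    _ = mu * (a * ρ + (1 - a) * 1) := by ring
    _ = mu * x := by rw [hax]

/-- The derivative of `G₁` at its smaller fixed point is at most one. -/
lemma tsum_deriv_rho_nonpos (h : FluidProfile p mu ρ τ W) :
    Summable (fun k : ℕ => ((k : ℝ) - 2) * ((k : ℝ) * p k * ρ ^ (k - 1))) ∧
      ∑' k : ℕ, ((k : ℝ) - 2) * ((k : ℝ) * p k * ρ ^ (k - 1)) ≤ 0 := by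
  have hρ := h.rho_mem
  have h1ρ : 0 < 1 - ρ := sub_pos.2 hρ.2
  have hs1 := h.summable_deriv (x := ρ) ⟨hρ.1, hρ.2.le⟩
  have hs2 : Summable fun k : ℕ => (k : ℝ) ^ 2 * p k * ρ ^ (k - 1) :=
    summable_mul_pow (fun k => mul_nonneg (sq_nonneg _) (h.p_nonneg k)) h.summable_sq
      ⟨hρ.1, hρ.2.le⟩ fun k => k - 1
  have hs : Summable (fun k : ℕ => ((k : ℝ) - 2) * ((k : ℝ) * p k * ρ ^ (k - 1))) :=
    (hs2.sub (hs1.mul_left 2)).congr fun k => by ring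
  refine ⟨hs, ?_⟩
  have hb := ((h.hasSum_mean.sub hs1.hasSum).mul_left ρ).sub (hs1.hasSum.mul_left (1 - ρ))
  have key : (1 - ρ) * ∑' k : ℕ, ((k : ℝ) - 2) * ((k : ℝ) * p k * ρ ^ (k - 1))
      ≤ ρ * (mu - pgfDeriv p ρ) - (1 - ρ) * pgfDeriv p ρ := by
    refine hasSum_le (fun k => ?_) (hs.hasSum.mul_left (1 - ρ)) hb
    rcases k with _ | k
    · simp
    have := mul_le_mul_of_nonneg_left (natCast_mul_pow_mul_le ⟨hρ.1, hρ.2.le⟩ k)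
      (h.mul_p_nonneg (k + 1))
    simp only [Nat.add_sub_cancel]
    push_cast at this ⊢
    nlinarith
  rw [h.fixed] at key
  have : ρ * (mu - mu * ρ) - (1 - ρ) * (mu * ρ) = 0 := by ring
  rw [this] at key
  exact nonpos_of_mul_nonpos_right key h1ρ

lemma drift_antitone (h : FluidProfile p mu ρ τ W) {u v : ℝ} (hu : 0 ≤ u) (huv : u ≤ v)
    (hv : v ≤ ρ) :
    v * pgfDeriv p v - 2 * pgf p v ≤ u * pgfDeriv p u - 2 * pgf p u := by
  have hρ := h.rho_mem
  have hsum : ∀ x ∈ Set.Icc (0 : ℝ) 1, HasSum (fun k : ℕ => ((k : ℝ) - 2) * p k * x ^ k)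
      (x * pgfDeriv p x - 2 * pgf p x) := fun x hx => by
    rw [← pgf_natCast_mul]
    refine ((h.summable_size hx).hasSum.sub ((summable_mul_pow h.p_nonneg h.hasSum_p.summable
      hx fun k => k).hasSum.mul_left 2)).congr_fun fun k => ?_
    ring
  have hd := h.tsum_deriv_rho_nonpos
  have hv1 : v ≤ 1 := hv.trans hρ.2.le
  have key : (v * pgfDeriv p v - 2 * pgf p v) - (u * pgfDeriv p u - 2 * pgf p u)
      ≤ (v - u) * ∑' k : ℕ, ((k : ℝ) - 2) * ((k : ℝ) * p k * ρ ^ (k - 1)) := by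
    refine hasSum_le (fun k => ?_) ((hsum v ⟨hu.trans huv, hv1⟩).sub
      (hsum u ⟨hu, huv.trans hv1⟩)) (hd.1.hasSum.mul_left (v - u))
    rcases k with _ | _ | k
    · simp [h.p_zero]
    · simp; linarith
    · have h1 := pow_sub_pow_le_mul_sub hu huv (k + 2)
      have h2 : v ^ (k + 2 - 1) ≤ ρ ^ (k + 2 - 1) := pow_le_pow_left₀ (hu.trans huv) hv _
      have h3 : v ^ (k + 2) - u ^ (k + 2) ≤ (k + 2 : ℕ) * ρ ^ (k + 2 - 1) * (v - u) :=
        h1.trans (mul_le_mul_of_nonneg_right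
          (mul_le_mul_of_nonneg_left h2 (Nat.cast_nonneg _)) (sub_nonneg.2 huv))
      have h4 : 0 ≤ ((k + 2 : ℕ) - 2 : ℝ) * p (k + 2) :=
        mul_nonneg (by push_cast; simp) (h.p_nonneg _)
      have := mul_le_mul_of_nonneg_left h3 h4
      calc _ = ((k + 2 : ℕ) - 2 : ℝ) * p (k + 2) * (v ^ (k + 2) - u ^ (k + 2)) := by ring
        _ ≤ _ := this
        _ = _ := by ring
  have := mul_nonpos_of_nonneg_of_nonpos (sub_nonneg.2 huv) hd.2
  linarith

lemma tau_pos (h : FluidProfile p mu ρ τ W) : 0 < τ := by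
  rw [h.tau_eq]
  have h1 : ρ ^ 2 < 1 := pow_lt_one₀ h.rho_mem.1 h.rho_mem.2 two_ne_zero
  have := h.mu_pos
  have : 0 < 1 - ρ ^ 2 := sub_pos.2 h1
  positivity

lemma one_sub_two_mul_tau_div (h : FluidProfile p mu ρ τ W) : 1 - 2 * τ / mu = ρ ^ 2 := by
  have := h.mu_pos
  rw [h.tau_eq]; field_simp; ring

lemma rho_sq_le (h : FluidProfile p mu ρ τ W) {t : ℝ} (ht : t ≤ τ) :
    ρ ^ 2 ≤ 1 - 2 * t / mu := by
  have := h.mu_pos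
  rw [← h.one_sub_two_mul_tau_div]
  gcongr

lemma W_of_mem (h : FluidProfile p mu ρ τ W) {t : ℝ} (ht : t ∈ Set.Icc 0 τ) :
    W t = Real.sqrt (1 - 2 * t / mu) := by
  rw [h.W_of_le t ht.2, max_eq_left ht.1]

lemma W_zero (h : FluidProfile p mu ρ τ W) : W 0 = 1 := by
  rw [h.W_of_mem ⟨le_rfl, h.tau_pos.le⟩]; simp

lemma W_tau (h : FluidProfile p mu ρ τ W) : W τ = ρ := by
  rw [h.W_of_mem ⟨h.tau_pos.le, le_rfl⟩, h.one_sub_two_mul_tau_div, Real.sqrt_sq h.rho_mem.1]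

lemma W_sq (h : FluidProfile p mu ρ τ W) {t : ℝ} (ht : t ∈ Set.Icc 0 τ) :
    W t ^ 2 = 1 - 2 * t / mu := by
  rw [h.W_of_mem ht, Real.sq_sqrt ((sq_nonneg ρ).trans (h.rho_sq_le ht.2))]

lemma mu_mul_W_sq (h : FluidProfile p mu ρ τ W) {t : ℝ} (ht : t ∈ Set.Icc 0 τ) :
    mu * W t ^ 2 = mu - 2 * t := by
  have := h.mu_pos
  rw [h.W_sq ht]; field_simp

lemma W_mem_Icc_rho_one (h : FluidProfile p mu ρ τ W) {t : ℝ} (ht : t ≤ τ) :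
    W t ∈ Set.Icc ρ 1 := by
  have hm := h.mu_pos
  rw [h.W_of_le t ht]
  constructor
  · exact Real.le_sqrt_of_sq_le (h.rho_sq_le (max_le ht h.tau_pos.le))
  · rw [Real.sqrt_le_one]
    have : 0 ≤ 2 * max t 0 / mu := by positivity
    linarith

lemma W_mem_unit (h : FluidProfile p mu ρ τ W) (t : ℝ) : W t ∈ Set.Icc (0 : ℝ) 1 := by
  rcases le_total t τ with ht | ht
  · exact Set.Icc_subset_Icc_left h.rho_mem.1 (h.W_mem_Icc_rho_one ht)
  · exact Set.Icc_subset_Icc_right h.rho_mem.2.le (h.W_mem t ht)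

lemma pgf_one (h : FluidProfile p mu ρ τ W) : pgf p 1 = 1 := by
  simp [pgf, h.hasSum_p.tsum_eq]

lemma excess_nonneg (h : FluidProfile p mu ρ τ W) (t : ℝ) : 0 ≤ excess p mu τ W t := by
  unfold excess
  split_ifs with ht
  · have h1 := h.pgfDeriv_le (h.W_mem_Icc_rho_one ht)
    have h2 := mul_le_mul_of_nonneg_left h1 (h.W_mem_unit t).1
    linarith
  · exact le_rfl

lemma total_eq (p : ℕ → ℝ) (mu τ : ℝ) (W : ℝ → ℝ) (t : ℝ) :
    total p mu τ W t = excess p mu τ W t + W t * pgfDeriv p (W t) := by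
  unfold total excess
  split_ifs <;> ring

lemma size_nonneg (h : FluidProfile p mu ρ τ W) (t : ℝ) : 0 ≤ W t * pgfDeriv p (W t) :=
  mul_nonneg (h.W_mem_unit t).1 (h.pgfDeriv_nonneg (h.W_mem_unit t).1)

lemma total_nonneg (h : FluidProfile p mu ρ τ W) (t : ℝ) : 0 ≤ total p mu τ W t := by
  rw [total_eq]
  exact add_nonneg (h.excess_nonneg t) (h.size_nonneg t)

lemma rate_nonneg (h : FluidProfile p mu ρ τ W) (k : ℕ) (t : ℝ) : 0 ≤ rate p mu τ W k t := by
  refine div_nonneg ?_ (h.total_nonneg t)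
  split_ifs
  · exact h.excess_nonneg t
  · exact mul_nonneg (h.mul_p_nonneg k) (pow_nonneg (h.W_mem_unit t).1 _)

lemma rate_le_one (h : FluidProfile p mu ρ τ W) (k : ℕ) (t : ℝ) : rate p mu τ W k t ≤ 1 := by
  refine div_le_one_of_le₀ ?_ (h.total_nonneg t)
  rw [total_eq]
  split_ifs
  · exact le_add_of_nonneg_right (h.size_nonneg t)
  · exact (h.mul_pow_le_size (h.W_mem_unit t) k).trans
      (le_add_of_nonneg_left (h.excess_nonneg t))

lemma exists_rate_le (h : FluidProfile p mu ρ τ W) :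
    ∃ K, 0 ≤ K ∧ ∀ k, 1 ≤ k → ∀ t, rate p mu τ W k t ≤ K * ((k : ℝ) * p k) := by
  have hm := h.mu_pos
  suffices ∃ K, 0 ≤ K ∧ ∀ k, 1 ≤ k → p k ≠ 0 → ∀ t, W t ^ k ≤ K * total p mu τ W t by
    obtain ⟨K, hK, hb⟩ := this
    refine ⟨K, hK, fun k hk t => ?_⟩
    have hp := h.mul_p_nonneg k
    refine div_le_of_le_mul₀ (h.total_nonneg t) (mul_nonneg hK hp) ?_
    rw [if_neg (by omega)]
    rcases eq_or_ne (p k) 0 with h0 | h0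
    · simp [h0]
    · have := mul_le_mul_of_nonneg_left (hb k hk h0 t) hp
      linarith
  rcases (h.p_nonneg 1).eq_or_lt with h1 | h1
  · have hρ : ρ = 0 := h.rho_eq_zero h1.symm
    refine ⟨1 / mu, by positivity, fun k hk hpk t => ?_⟩
    have hk2 : 2 ≤ k := by
      rcases hk.eq_or_lt with rfl | hk
      · exact absurd h1.symm hpk
      · exact hk
    have hW := h.W_mem_unit t
    by_cases ht : t ≤ τ
    · rw [total, if_pos ht]
      calc W t ^ k ≤ W t ^ 2 := pow_le_pow_of_le_one hW.1 hW.2 hk2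
        _ = _ := by field_simp
    · have := h.W_mem t (not_le.1 ht).le
      rw [hρ] at this
      rw [le_antisymm this.2 this.1, zero_pow (by omega)]
      exact mul_nonneg (by positivity) (h.total_nonneg t)
  · have hρ := h.rho_pos h1
    refine ⟨1 / (mu * ρ) + 1 / p 1, by positivity, fun k hk _ t => ?_⟩
    have hW := h.W_mem_unit t
    have hWk : W t ^ k ≤ W t := pow_le_of_le_one hW.1 hW.2 (by omega)
    have htot := h.total_nonneg t
    rw [add_mul]
    by_cases ht : t ≤ τ
    · have hWρ := (h.W_mem_Icc_rho_one ht).1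
      have : W t ≤ 1 / (mu * ρ) * total p mu τ W t := by
        rw [total, if_pos ht]
        field_simp
        nlinarith
      have h3 : 0 ≤ 1 / p 1 * total p mu τ W t := by positivity
      linarith
    · have : W t ≤ 1 / p 1 * total p mu τ W t := by
        rw [total, if_neg ht]
        field_simp
        have := mul_le_mul_of_nonneg_left (h.p_one_le_pgfDeriv hW) hW.1
        linarith
      have h3 : 0 ≤ 1 / (mu * ρ) * total p mu τ W t := by positivity
      linarith

lemma continuous_pgf_W (h : FluidProfile p mu ρ τ W) : Continuous fun t => pgf p (W t) :=
  (continuousOn_pgf h.p_nonneg h.hasSum_p.summable).comp_continuous h.continuous_W h.W_mem_unit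

lemma continuous_size_W (h : FluidProfile p mu ρ τ W) :
    Continuous fun t => W t * pgfDeriv p (W t) := by
  simp only [← pgf_natCast_mul]
  exact (continuousOn_pgf h.mul_p_nonneg h.hasSum_mean.summable).comp_continuous
    h.continuous_W h.W_mem_unit

lemma measurable_rate (h : FluidProfile p mu ρ τ W) (k : ℕ) : Measurable (rate p mu τ W k) := by
  have hW := h.continuous_W.measurable
  have hS := h.continuous_size_W.measurable
  have he : Measurable (excess p mu τ W) :=
    Measurable.ite measurableSet_Iic ((hW.pow_const 2).const_mul mu |>.sub hS) measurable_const
  have ht : Measurable (total p mu τ W) :=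
    Measurable.ite measurableSet_Iic ((hW.pow_const 2).const_mul mu) hS
  refine Measurable.div ?_ ht
  split_ifs
  · exact he
  · exact (hW.pow_const k).const_mul _

lemma intervalIntegrable_rate (h : FluidProfile p mu ρ τ W) (k : ℕ) (a b : ℝ) :
    IntervalIntegrable (rate p mu τ W k) volume a b := by
  refine (intervalIntegrable_const (c := (1 : ℝ))).mono_fun
    (h.measurable_rate k).aestronglyMeasurable (Eventually.of_forall fun t => ?_)
  simp only [norm_one, Real.norm_of_nonneg (h.rate_nonneg k t)]
  exact h.rate_le_one k t

lemma hasDerivAt_W (h : FluidProfile p mu ρ τ W) {t : ℝ} (ht : 0 < t) (h1 : t ≠ τ)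
    (h2 : t ≠ τ + pgf p ρ) : HasDerivAt W (-(W t / total p mu τ W t)) t := by
  have hm := h.mu_pos
  rcases lt_or_gt_of_ne h1 with hlt | hgt
  · have heq : W =ᶠ[𝓝 t] fun s => Real.sqrt (1 - 2 * s / mu) := by
      filter_upwards [Ioo_mem_nhds ht hlt] with s hs
      exact h.W_of_mem ⟨hs.1.le, hs.2.le⟩
    have hpos : 0 < 1 - 2 * t / mu := by
      have : 2 * t / mu < 2 * τ / mu := by gcongr
      have := h.one_sub_two_mul_tau_div
      have := sq_nonneg ρ
      linarith
    have hWpos : 0 < W t := by rw [h.W_of_mem ⟨ht.le, hlt.le⟩]; exact Real.sqrt_pos.2 hpos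
    have hd : HasDerivAt (fun s => 1 - 2 * s / mu) (-(2 / mu)) t := by
      simpa using (((hasDerivAt_id t).const_mul 2).div_const mu).const_sub 1
    refine ((hd.sqrt hpos.ne').congr_of_eventuallyEq heq).congr_deriv ?_
    rw [← h.W_of_mem ⟨ht.le, hlt.le⟩, total, if_pos hlt.le]
    field_simp
  · have hgt' : τ < t := hgt
    rcases lt_or_gt_of_ne h2 with hlt | hgt2
    · have hGW := h.pgf_W t hgt'.le
      rw [max_eq_left (by linarith)] at hGW
      have hmem := h.W_mem t hgt'.le
      have hW0 : W t ≠ 0 := fun h0 => by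
        rw [h0, pgf_zero h.p_zero] at hGW; linarith
      have hWpos : 0 < W t := lt_of_le_of_ne hmem.1 hW0.symm
      have hp1 : 0 < p 1 := lt_of_le_of_ne (h.p_nonneg 1) fun h0 => by
        have := h.rho_eq_zero h0.symm
        linarith [hmem.2]
      have hG' : 0 < pgfDeriv p (W t) := hp1.trans_le (h.p_one_le_pgfDeriv (h.W_mem_unit t))
      have hd := (hasDerivAt_pgf h.p_nonneg h.hasSum_p.summable h.hasSum_mean.summable
        (x := W t) ⟨hmem.1, hmem.2.trans_lt h.rho_mem.2⟩).const_sub (τ + pgf p ρ)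
      have hinv : ∀ᶠ s in 𝓝 t, τ + pgf p ρ - pgf p (W s) = s := by
        filter_upwards [Ioo_mem_nhds hgt' hlt] with s hs
        rw [h.pgf_W s hs.1.le, max_eq_left (by linarith [hs.2])]
        ring
      refine (HasDerivAt.of_local_left_inverse h.continuous_W.continuousAt hd
        (neg_ne_zero.2 hG'.ne') hinv).congr_deriv ?_
      rw [total, if_neg hgt'.not_ge]
      field_simp
    · have hzero : ∀ s, τ + pgf p ρ < s → τ ≤ s → W s = 0 := fun s hs hs' => by
        have hmem := h.W_mem s hs'
        have hG := h.pgf_W s hs'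
        rw [max_eq_right (by linarith)] at hG
        rcases (h.p_nonneg 1).eq_or_lt with h0 | h0
        · rw [h.rho_eq_zero h0.symm] at hmem
          exact le_antisymm hmem.2 hmem.1
        · have := mul_sub_le_pgf_sub h.p_nonneg h.hasSum_p.summable le_rfl hmem.1
            (h.W_mem_unit s).2
          rw [hG, pgf_zero h.p_zero] at this
          nlinarith [hmem.1]
      have heq : W =ᶠ[𝓝 t] fun _ => 0 := by
        filter_upwards [Ioi_mem_nhds hgt2, Ioi_mem_nhds hgt'] with s hs hs'
        exact hzero s hs hs'.le
      rw [hzero t hgt2 hgt'.le]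
      simpa using (hasDerivAt_const t (0 : ℝ)).congr_of_eventuallyEq heq

lemma integral_rate (h : FluidProfile p mu ρ τ W) {k : ℕ} (hk : 1 ≤ k) {t : ℝ} (ht : 0 ≤ t) :
    ∫ s in (0 : ℝ)..t, rate p mu τ W k s = p k - p k * W t ^ k := by
  have := integral_eq_of_hasDerivAt_off_countable (fun s => -(p k * W s ^ k))
    (rate p mu τ W k) (a := 0) (b := t) (s := {τ, τ + pgf p ρ})
    ((Set.countable_singleton _).insert _)
    (((h.continuous_W.pow k).const_mul (p k)).neg.continuousOn) (fun s hs => ?_)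
    (h.intervalIntegrable_rate k 0 t)
  · rw [this, h.W_zero]; simp; ring
  · obtain ⟨hs, hn⟩ := hs
    rw [min_eq_left ht, max_eq_right ht] at hs
    simp only [Set.mem_insert_iff, Set.mem_singleton_iff, not_or] at hn
    refine (((h.hasDerivAt_W hs.1 hn.1 hn.2).pow k).const_mul (p k)).neg.congr_deriv ?_
    rw [rate, if_neg (by omega)]
    obtain ⟨n, rfl⟩ : ∃ n, k = n + 1 := ⟨k - 1, by omega⟩
    simp only [Nat.add_sub_cancel, pow_succ]
    ring

lemma integral_rate_zero (h : FluidProfile p mu ρ τ W) {t : ℝ} (ht : t ∈ Set.Icc 0 τ) :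
    ∫ s in (0 : ℝ)..t, rate p mu τ W 0 s = t - 1 + pgf p (W t) := by
  have hm := h.mu_pos
  rw [intervalIntegral.integral_eq_sub_of_hasDerivAt_of_le ht.1
    (f := fun s => s + pgf p (W s)) (continuous_id.add h.continuous_pgf_W).continuousOn
    (fun s hs => ?_) (h.intervalIntegrable_rate 0 0 t), h.W_zero, h.pgf_one]
  · ring
  · have hsτ : s < τ := hs.2.trans_le ht.2
    have hG0 : 0 ≤ pgf p ρ := pgf_nonneg h.p_nonneg h.rho_mem.1
    have hsq := h.mu_mul_W_sq ⟨hs.1.le, hsτ.le⟩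
    have hmem := h.W_mem_unit s
    have h2τ : 2 * τ ≤ mu := by
      rw [h.tau_eq]; nlinarith [sq_nonneg ρ]
    have hW0 : W s ≠ 0 := fun h0 => by
      rw [h0] at hsq; norm_num at hsq; linarith
    have hW1 : W s ≠ 1 := fun h0 => by
      rw [h0] at hsq; norm_num at hsq; linarith [hs.1]
    have hd := hasDerivAt_pgf h.p_nonneg h.hasSum_p.summable h.hasSum_mean.summable
      (x := W s) ⟨hmem.1, lt_of_le_of_ne hmem.2 hW1⟩
    refine ((hasDerivAt_id s).add
      (hd.comp s (h.hasDerivAt_W hs.1 hsτ.ne (by linarith)))).congr_deriv ?_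
    rw [rate, if_pos rfl, excess, total, if_pos hsτ.le, if_pos hsτ.le]
    field_simp
    ring

lemma rate_zero_of_lt {t : ℝ} (ht : τ < t) : rate p mu τ W 0 t = 0 := by
  simp [rate, excess, ht.not_ge]

lemma integral_rate_zero_of_le (h : FluidProfile p mu ρ τ W) {t : ℝ} (ht : τ ≤ t) :
    ∫ s in (0 : ℝ)..t, rate p mu τ W 0 s = ∫ s in (0 : ℝ)..τ, rate p mu τ W 0 s := by
  rw [← intervalIntegral.integral_add_adjacent_intervals
    (h.intervalIntegrable_rate 0 0 τ) (h.intervalIntegrable_rate 0 τ t),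
    add_eq_left]
  refine intervalIntegral.integral_zero_ae ?_
  refine Eventually.of_forall fun s hs => ?_
  rw [Set.uIoc_of_le ht] at hs
  exact rate_zero_of_lt hs.1

lemma hasSum_drift (h : FluidProfile p mu ρ τ W) {t : ℝ} (ht : 0 ≤ t) :
    HasSum (fun k : ℕ => ((k : ℝ) - 2) * ∫ s in (0 : ℝ)..t, rate p mu τ W k s)
      (-2 * (∫ s in (0 : ℝ)..t, rate p mu τ W 0 s)
        + (mu - W t * pgfDeriv p (W t) - 2 * (1 - pgf p (W t)))) := by
  have hW := h.W_mem_unit t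
  have hG := (summable_mul_pow h.p_nonneg h.hasSum_p.summable hW fun k => k).hasSum
  have hH := (h.summable_size hW).hasSum
  have h0 := hasSum_ite_eq (0 : ℕ) (-2 * ∫ s in (0 : ℝ)..t, rate p mu τ W 0 s)
  have hall := h0.add ((h.hasSum_mean.sub hH).sub ((h.hasSum_p.sub hG).mul_left 2))
  rw [← pgf_natCast_mul]
  refine hall.congr_fun fun k => ?_
  rcases k with _ | k
  · simp [h.p_zero]
  · rw [h.integral_rate (by omega) ht]
    simp
    ring

lemma drift_eq_excess (h : FluidProfile p mu ρ τ W) {t : ℝ} (ht : t ∈ Set.Icc 0 τ) :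
    ∑' k : ℕ, ((k : ℝ) - 2) * ∫ s in (0 : ℝ)..t, rate p mu τ W k s = excess p mu τ W t := by
  rw [(h.hasSum_drift ht.1).tsum_eq, h.integral_rate_zero ht, excess, if_pos ht.2,
    h.mu_mul_W_sq ht]
  ring

lemma excess_tau (h : FluidProfile p mu ρ τ W) : excess p mu τ W τ = 0 := by
  rw [excess, if_pos le_rfl, h.W_tau, h.fixed]; ring

lemma W_antitoneOn (h : FluidProfile p mu ρ τ W) : AntitoneOn W (Set.Ici τ) := by
  intro s hs t ht hst
  by_contra! hlt
  have hs' := h.W_mem s hs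
  have ht' := h.W_mem t ht
  have h1 := mul_sub_le_pgf_sub h.p_nonneg h.hasSum_p.summable hs'.1 hlt.le (h.W_mem_unit t).2
  have h2 : pgf p (W t) ≤ pgf p (W s) := by
    rw [h.pgf_W s hs, h.pgf_W t ht]; gcongr
  rcases (h.p_nonneg 1).eq_or_lt with h0 | h0
  · have := h.rho_eq_zero h0.symm
    linarith [hs'.1, ht'.2]
  · have := mul_pos h0 (sub_pos.2 hlt)
    linarith

lemma drift_antitoneOn (h : FluidProfile p mu ρ τ W) :
    AntitoneOn (fun t => ∑' k : ℕ, ((k : ℝ) - 2) * ∫ s in (0 : ℝ)..t, rate p mu τ W k s)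
      (Set.Ici τ) := by
  intro s hs t ht hst
  have hs' : τ ≤ s := hs
  have ht' : τ ≤ t := ht
  have h0 := h.tau_pos
  simp only
  rw [(h.hasSum_drift (h0.le.trans hs')).tsum_eq, (h.hasSum_drift (h0.le.trans ht')).tsum_eq,
    h.integral_rate_zero_of_le hs', h.integral_rate_zero_of_le ht']
  have := h.drift_antitone (h.W_mem t ht').1 (h.W_antitoneOn hs ht hst) (h.W_mem s hs').2
  linarith

lemma exists_lipschitz_drift (h : FluidProfile p mu ρ τ W) :
    ∃ C, ∀ s t, 0 ≤ s → s ≤ t →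
      |(∑' k : ℕ, ((k : ℝ) - 2) * ∫ x in (0 : ℝ)..t, rate p mu τ W k x)
        - ∑' k : ℕ, ((k : ℝ) - 2) * ∫ x in (0 : ℝ)..s, rate p mu τ W k x| ≤ C * (t - s) := by
  obtain ⟨K, hK, hb⟩ := h.exists_rate_le
  have hC := (hasSum_ite_eq (0 : ℕ) (2 : ℝ)).add (h.summable_sq.hasSum.mul_left K)
  refine ⟨2 + K * ∑' k : ℕ, (k : ℝ) ^ 2 * p k, fun s t hs hst => ?_⟩
  rw [← (h.hasSum_drift (hs.trans hst)).summable.tsum_sub (h.hasSum_drift hs).summable,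
    ← Real.norm_eq_abs]
  refine tsum_of_norm_bounded (hC.mul_right (t - s)) fun k => ?_
  rw [← mul_sub, intervalIntegral.integral_interval_sub_left
    (h.intervalIntegrable_rate k 0 t) (h.intervalIntegrable_rate k 0 s), norm_mul]
  have hts : 0 ≤ t - s := sub_nonneg.2 hst
  rcases k with _ | k
  · have := intervalIntegral.norm_integral_le_of_norm_le_const (a := s) (b := t) (C := 1)
      (f := rate p mu τ W 0) fun x _ => by
        rw [Real.norm_of_nonneg (h.rate_nonneg 0 x)]; exact h.rate_le_one 0 x
    rw [abs_of_nonneg hts] at this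
    simp at this ⊢
    linarith
  · have := intervalIntegral.norm_integral_le_of_norm_le_const (a := s) (b := t)
      (C := K * ((k + 1 : ℕ) * p (k + 1))) (f := rate p mu τ W (k + 1)) fun x _ => by
        rw [Real.norm_of_nonneg (h.rate_nonneg _ x)]; exact hb _ (by omega) x
    rw [abs_of_nonneg hts] at this
    have hk : ‖((k + 1 : ℕ) : ℝ) - 2‖ ≤ (k + 1 : ℕ) := by
      have : (0 : ℝ) ≤ k := k.cast_nonneg
      rw [Real.norm_eq_abs, abs_le]; push_cast; constructor <;> linarith
    refine (mul_le_mul hk this (norm_nonneg _) (Nat.cast_nonneg _)).trans_eq ?_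
    simp
    ring

lemma drift_zero : ∑' k : ℕ, ((k : ℝ) - 2) * ∫ s in (0 : ℝ)..0, rate p mu τ W k s = 0 := by
  simp

/-- Reflecting the drift at zero leaves it unchanged up to time `τ` and kills it afterwards. -/
lemma skorokhod_eq_excess (h : FluidProfile p mu ρ τ W) {ψ : ℝ → ℝ} {t : ℝ} (ht : 0 ≤ t)
    (hψ : ∀ s ∈ Set.Icc 0 t,
      ψ s = ∑' k : ℕ, ((k : ℝ) - 2) * ∫ x in (0 : ℝ)..s, rate p mu τ W k x) :
    skorokhod ψ t = excess p mu τ W t := by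
  have hτ := h.tau_pos
  rcases le_or_gt t τ with htτ | htτ
  · have hleast : IsLeast (ψ '' Set.Icc 0 t) 0 := by
      refine ⟨⟨0, ⟨le_rfl, ht⟩, by rw [hψ 0 ⟨le_rfl, ht⟩, drift_zero]⟩, ?_⟩
      rintro _ ⟨s, hs, rfl⟩
      rw [hψ s hs, h.drift_eq_excess ⟨hs.1, hs.2.trans htτ⟩]
      exact h.excess_nonneg s
    rw [skorokhod, hleast.csInf_eq, min_self, sub_zero, hψ t ⟨ht, le_rfl⟩,
      h.drift_eq_excess ⟨ht, htτ⟩]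
  · have hψτ : ψ τ = 0 := by
      rw [hψ τ ⟨hτ.le, htτ.le⟩, h.drift_eq_excess ⟨hτ.le, le_rfl⟩, h.excess_tau]
    have hmono : ∀ s ∈ Set.Icc τ t, ψ t ≤ ψ s := fun s hs => by
      rw [hψ t ⟨ht, le_rfl⟩, hψ s ⟨hτ.le.trans hs.1, hs.2⟩]
      exact h.drift_antitoneOn hs.1 htτ.le hs.2
    have hle : ψ t ≤ 0 := hψτ ▸ hmono τ ⟨le_rfl, htτ.le⟩
    have hleast : IsLeast (ψ '' Set.Icc 0 t) (ψ t) := by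
      refine ⟨⟨t, ⟨ht, le_rfl⟩, rfl⟩, ?_⟩
      rintro _ ⟨s, hs, rfl⟩
      rcases le_total s τ with hsτ | hsτ
      · rw [hψ s hs, h.drift_eq_excess ⟨hs.1, hsτ⟩]
        exact hle.trans (h.excess_nonneg s)
      · exact hmono s ⟨hsτ, hs.2⟩
    rw [skorokhod, hleast.csInf_eq, min_eq_left hle, sub_self, excess, if_neg htτ.not_ge]

lemma continuous_excess (h : FluidProfile p mu ρ τ W) : Continuous (excess p mu τ W) := by
  refine Continuous.if_le (by have := h.continuous_W; have := h.continuous_size_W; fun_prop)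
    continuous_const continuous_id continuous_const fun t ht => ?_
  have := h.excess_tau
  rw [excess, if_pos le_rfl] at this
  rw [show t = τ from ht, this]

lemma lipschitz_pow (h : FluidProfile p mu ρ τ W) {k : ℕ} (hk : 1 ≤ k) {s t : ℝ} (hs : 0 ≤ s)
    (hst : s ≤ t) : |p k * W t ^ k - p k * W s ^ k| ≤ 1 * (t - s) := by
  have h1 := h.integral_rate hk hs
  have h2 := h.integral_rate hk (hs.trans hst)
  have h3 : p k * W t ^ k - p k * W s ^ k = -∫ x in s..t, rate p mu τ W k x := by
    rw [← intervalIntegral.integral_interval_sub_left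
      (h.intervalIntegrable_rate k 0 t) (h.intervalIntegrable_rate k 0 s), h1, h2]
    ring
  have := intervalIntegral.norm_integral_le_of_norm_le_const (a := s) (b := t) (C := 1)
    (f := rate p mu τ W k) fun x _ => by
      rw [Real.norm_of_nonneg (h.rate_nonneg k x)]; exact h.rate_le_one k x
  rwa [abs_of_nonneg (sub_nonneg.2 hst), Real.norm_eq_abs, ← abs_neg, ← h3] at this

lemma pow_antitone (h : FluidProfile p mu ρ τ W) {k : ℕ} (hk : 1 ≤ k) {s t : ℝ} (hs : 0 ≤ s)
    (hst : s ≤ t) : p k * W t ^ k ≤ p k * W s ^ k := by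
  have h1 := h.integral_rate hk hs
  have h2 := h.integral_rate hk (hs.trans hst)
  have h3 := intervalIntegral.integral_interval_sub_left
    (h.intervalIntegrable_rate k 0 t) (h.intervalIntegrable_rate k 0 s)
  have h4 : 0 ≤ ∫ x in s..t, rate p mu τ W k x :=
    intervalIntegral.integral_nonneg hst fun x _ => h.rate_nonneg k x
  linarith

lemma memCT_of_eq (h : FluidProfile p mu ρ τ W) {T : ℝ} {ζ : ℕ → ℝ → ℝ} {ψ : ℝ → ℝ}
    (hζ0 : ∀ t, 0 ≤ t → ζ 0 t = excess p mu τ W t)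
    (hζ : ∀ k, 1 ≤ k → ∀ t, 0 ≤ t → ζ k t = p k * W t ^ k)
    (hψ : ∀ t, 0 ≤ t →
      ψ t = ∑' k : ℕ, ((k : ℝ) - 2) * ∫ x in (0 : ℝ)..t, rate p mu τ W k x) :
    memCT T p ζ ψ := by
  obtain ⟨C, hC⟩ := h.exists_lipschitz_drift
  have hψL : ∀ s ∈ Set.Icc 0 T, ∀ t ∈ Set.Icc 0 T, s ≤ t → |ψ t - ψ s| ≤ C * (t - s) :=
    fun s hs t ht hst => by rw [hψ s hs.1, hψ t ht.1]; exact hC s t hs.1 hst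
  have hζL : ∀ k, 1 ≤ k → ∀ s ∈ Set.Icc 0 T, ∀ t ∈ Set.Icc 0 T, s ≤ t →
      |ζ k t - ζ k s| ≤ 1 * (t - s) :=
    fun k hk s hs t ht hst => by
      rw [hζ k hk s hs.1, hζ k hk t ht.1]; exact h.lipschitz_pow hk hs.1 hst
  refine ⟨fun k => ?_, continuousOn_of_lipschitz hψL, ?_, AbsCont.of_lipschitz hψL,
    fun t ht => ?_, fun k hk => ⟨?_, fun t ht => ?_, fun s hs t ht hst => ?_,
      AbsCont.of_lipschitz (hζL k hk)⟩⟩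
  · rcases k with _ | k
    · exact h.continuous_excess.continuousOn.congr fun t ht => hζ0 t ht.1
    · exact continuousOn_of_lipschitz (hζL _ (by omega))
  · rw [hψ 0 le_rfl, drift_zero]
  · rw [hζ0 t ht.1, h.skorokhod_eq_excess ht.1 fun s hs => hψ s hs.1]
  · rw [hζ k hk 0 le_rfl, h.W_zero, one_pow, mul_one]
  · rw [hζ k hk t ht.1]
    exact mul_nonneg (h.p_nonneg k) (pow_nonneg (h.W_mem_unit t).1 _)
  · rw [hζ k hk s hs.1, hζ k hk t ht.1]
    exact h.pow_antitone hk hs.1 hst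

lemma rcoord_eq_rate (h : FluidProfile p mu ρ τ W) {x : ℕ → ℝ} {t : ℝ}
    (hx0 : x 0 = excess p mu τ W t) (hx : ∀ k, 1 ≤ k → x k = p k * W t ^ k) (k : ℕ) :
    rcoord x k = rate p mu τ W k t := by
  have htot : rtot x = total p mu τ W t := by
    rw [rtot, hx0, max_eq_left (h.excess_nonneg t), total_eq, ← pgf_natCast_mul]
    congr 1
    refine tsum_congr fun k => ?_
    rcases k with _ | k
    · simp
    · rw [hx _ (by omega)]; ring
  rw [rcoord, htot, rate]
  rcases (h.total_nonneg t).eq_or_lt with h0 | h0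
  · simp [← h0]
  · rw [if_pos h0]
    congr 1
    split_ifs with hk
    · rw [hx0, max_eq_left (h.excess_nonneg t)]
    · rw [hx k (by omega)]; ring

end FluidProfile

lemma continuousOn_of_pgf_eq_max {p : ℕ → ℝ} (hp : ∀ k, 0 ≤ p k) (hs : Summable p)
    (hp1 : 0 < p 1) {c : ℝ} {U : ℝ → ℝ} (hU : ∀ s, 0 ≤ s → U s ∈ Set.Icc (0 : ℝ) 1)
    (hG : ∀ s, 0 ≤ s → pgf p (U s) = max (c - s) 0) : ContinuousOn U (Set.Ici 0) := by
  refine (LipschitzOnWith.of_dist_le_mul (K := (1 / p 1).toNNReal)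
    fun s hs' t ht' => ?_).continuousOn
  rw [Real.coe_toNNReal _ (by positivity), Real.dist_eq, Real.dist_eq]
  have hUs := hU s hs'
  have hUt := hU t ht'
  have h1 : p 1 * |U s - U t| ≤ |pgf p (U s) - pgf p (U t)| := by
    rcases le_total (U s) (U t) with hle | hle
    · rw [abs_sub_comm, abs_sub_comm (pgf p _), abs_of_nonneg (sub_nonneg.2 hle)]
      exact (mul_sub_le_pgf_sub hp hs hUs.1 hle hUt.2).trans (le_abs_self _)
    · rw [abs_of_nonneg (sub_nonneg.2 hle)]
      exact (mul_sub_le_pgf_sub hp hs hUt.1 hle hUs.2).trans (le_abs_self _)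
  have h2 : |pgf p (U s) - pgf p (U t)| ≤ |s - t| := by
    rw [hG s hs', hG t ht', abs_sub_comm s t]
    refine (abs_max_sub_max_le_abs _ _ _).trans_eq ?_
    congr 1; ring
  field_simp
  linarith

lemma fluidProfile_of_inverse {p : ℕ → ℝ} {mu ρ τ : ℝ} {f : ℝ → ℝ} (hp0 : p 0 = 0)
    (hpnn : ∀ k, 0 ≤ p k) (hp : HasSum p 1)
    (hsq : Summable fun k : ℕ => (k : ℝ) ^ 2 * p k)
    (hmean : HasSum (fun k : ℕ => (k : ℝ) * p k) mu) (hmu : 0 < mu)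
    (hρ : ρ ∈ Set.Ico (0 : ℝ) 1) (hρ0 : p 1 = 0 → ρ = 0) (hρpos : 0 < p 1 → 0 < ρ)
    (hfix : pgfDeriv p ρ = mu * ρ) (hτ : τ = mu / 2 * (1 - ρ ^ 2))
    (hf : ∀ s, 0 ≤ s → s ≤ pgf p ρ → f s ∈ Set.Icc (0 : ℝ) 1 ∧ pgf p ρ - pgf p (ρ * f s) = s)
    (hf0 : ∀ s, pgf p ρ < s → f s = 0) :
    FluidProfile p mu ρ τ
      (fun t => if t ≤ τ then Real.sqrt (1 - 2 * max t 0 / mu) else ρ * f (t - τ)) := by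
  have hUmem : ∀ s, 0 ≤ s → ρ * f s ∈ Set.Icc 0 ρ := fun s hs => by
    rcases le_or_gt s (pgf p ρ) with h | h
    · have := (hf s hs h).1
      exact ⟨mul_nonneg hρ.1 this.1, mul_le_of_le_one_right hρ.1 this.2⟩
    · rw [hf0 s h]; simpa using hρ.1
  have hUG : ∀ s, 0 ≤ s → pgf p (ρ * f s) = max (pgf p ρ - s) 0 := fun s hs => by
    rcases le_or_gt s (pgf p ρ) with h | h
    · rw [max_eq_left (sub_nonneg.2 h)]; linarith [(hf s hs h).2]
    · rw [hf0 s h, mul_zero, pgf_zero hp0, max_eq_right (by linarith)]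
  have hG0 : 0 ≤ pgf p ρ := pgf_nonneg hpnn hρ.1
  have hUcont : ContinuousOn (fun s => ρ * f s) (Set.Ici 0) := by
    rcases (hpnn 1).eq_or_lt with h | h
    · simpa [hρ0 h.symm] using continuousOn_const
    · exact continuousOn_of_pgf_eq_max hpnn hp.summable h
        (fun s hs => Set.Icc_subset_Icc_right hρ.2.le (hUmem s hs)) hUG
  have hU0 : ρ * f 0 = ρ := by
    rcases (hpnn 1).eq_or_lt with h | h
    · simp [hρ0 h.symm]
    · have h0 := hUmem 0 le_rfl
      have := mul_sub_le_pgf_sub hpnn hp.summable h0.1 h0.2 hρ.2.le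
      rw [hUG 0 le_rfl, sub_zero, max_eq_left hG0, sub_self] at this
      exact le_antisymm h0.2 (by nlinarith)
  have hτ0 : 0 ≤ τ := by
    have : ρ ^ 2 ≤ 1 := pow_le_one₀ hρ.1 hρ.2.le
    rw [hτ]
    exact mul_nonneg (by positivity) (sub_nonneg.2 this)
  have hsqrt : Real.sqrt (1 - 2 * max τ 0 / mu) = ρ := by
    have : 1 - 2 * τ / mu = ρ ^ 2 := by rw [hτ]; field_simp; ring
    rw [max_eq_left hτ0, this, Real.sqrt_sq hρ.1]
  have hW : ∀ t, τ ≤ t →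
      (if t ≤ τ then Real.sqrt (1 - 2 * max t 0 / mu) else ρ * f (t - τ)) = ρ * f (t - τ) :=
    fun t ht => by
      split_ifs with h
      · rw [le_antisymm h ht, hsqrt, sub_self, hU0]
      · rfl
  refine ⟨hp0, hpnn, hp, hmean, hsq, hmu, hρ, hρ0, hρpos, hfix, hτ, ?_, fun t ht => if_pos ht,
    fun t ht => ?_, fun t ht => ?_⟩
  · have hcont : Continuous fun t => ρ * f (max (t - τ) 0) :=
      hUcont.comp_continuous (f := fun t => max (t - τ) 0) (by fun_prop)
        fun t => Set.mem_Ici.2 (le_max_right _ _)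
    have := Continuous.if_le (f := id) (g := fun _ => τ)
      (f' := fun t => Real.sqrt (1 - 2 * max t 0 / mu)) (by fun_prop) hcont
      continuous_id continuous_const fun t (ht : t = τ) => by
        rw [ht, hsqrt, sub_self, max_self, hU0]
    refine this.congr fun t => ?_
    by_cases h : t ≤ τ
    · simp [h]
    · simp [h, (not_le.1 h).le]
  · rw [hW t ht]; exact hUmem _ (sub_nonneg.2 ht)
  · rw [hW t ht]; exact hUG _ (sub_nonneg.2 ht)

/-- Law of large numbers, supercritical case `∑ k(k-2)p_k > 0`:
with `ρ` the fixed point of `G₁`, `τ = (μ/2)(1-ρ²)` and `f_ρ` the inverse of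
`F_ρ(t) = G₀(ρ) - G₀(ρ t)`, the explicit pair `(ζ, ψ)` belongs to `C_T` and has
zero rate. The distribution `p` is indexed by `ℕ` with `p 0 = 0`. -/
theorem lln_supercritical (T : ℝ)
    (p : ℕ → ℝ) (hp0 : p 0 = 0) (hpnn : ∀ k, 0 ≤ p k) (hp1 : ∑' k : ℕ, p k = 1)
    (hmom2 : Summable fun k : ℕ => (k : ℝ) ^ 2 * p k)
    (hsup : 0 < ∑' k : ℕ, (k : ℝ) * ((k : ℝ) - 2) * p k)
    (mu : ℝ) (hmu : mu = ∑' k : ℕ, (k : ℝ) * p k)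
    (hT : mu / 2 ≤ T)
    (ρ : ℝ) (hρmem : ρ ∈ Set.Ico (0 : ℝ) 1)
    (hρcase : (p 1 = 0 → ρ = 0) ∧ (0 < p 1 → 0 < ρ))
    (hρfix : ∑' k : ℕ, ((k : ℝ) * p k / mu) * ρ ^ (k - 1) = ρ)
    (τ : ℝ) (hτ : τ = mu / 2 * (1 - ρ ^ 2))
    (fρ : ℝ → ℝ)
    (hfρinv : ∀ t : ℝ, 0 ≤ t → t ≤ ∑' k : ℕ, p k * ρ ^ k →
      fρ t ∈ Set.Icc (0 : ℝ) 1 ∧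
        (∑' k : ℕ, p k * ρ ^ k) - ∑' k : ℕ, p k * (ρ * fρ t) ^ k = t)
    (hfρzero : ∀ t : ℝ, (∑' k : ℕ, p k * ρ ^ k) < t → fρ t = 0)
    (hρzero : ρ = 0 → ∀ t : ℝ, 0 ≤ t → fρ t = 0)
    (ζ : ℕ → ℝ → ℝ) (ψ : ℝ → ℝ)
    (hζ0 : ∀ t, ζ 0 t =
      if t ∈ Set.Icc (0 : ℝ) τ then
        mu - 2 * t - mu * Real.sqrt (1 - 2 * t / mu) *
          ∑' k : ℕ, ((k : ℝ) * p k / mu) * Real.sqrt (1 - 2 * t / mu) ^ (k - 1)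
      else 0)
    (hζk : ∀ k : ℕ, 1 ≤ k → ∀ t : ℝ,
      (0 ≤ t → t ≤ τ → ζ k t = p k * (1 - 2 * t / mu) ^ ((k : ℝ) / 2)) ∧
      (τ < t → ζ k t = p k * ρ ^ k * (fρ (t - τ)) ^ k))
    (hψ : ∀ t, ψ t =
      -2 * (∫ s in (0 : ℝ)..t, rcoord (fun j => ζ j s) 0)
        + ∑' k : ℕ, (((k : ℝ) + 1) - 2) * (p (k + 1) - ζ (k + 1) t)) :
    0 < τ ∧ memCT T p ζ ψ ∧ rateI T p ζ ψ = 0 := by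
  have hp : HasSum p 1 := by
    have : Summable p := by
      by_contra hn
      rw [tsum_eq_zero_of_not_summable hn] at hp1
      exact zero_ne_one hp1
    exact hp1 ▸ this.hasSum
  have hmeans : Summable fun k : ℕ => (k : ℝ) * p k := by
    refine hmom2.of_nonneg_of_le (fun k => mul_nonneg k.cast_nonneg (hpnn k)) fun k => ?_
    refine mul_le_mul_of_nonneg_right ?_ (hpnn k)
    exact_mod_cast Nat.le_self_pow two_ne_zero k
  have hmean : HasSum (fun k : ℕ => (k : ℝ) * p k) mu := hmu ▸ hmeans.hasSum
  have hmu0 : 0 < mu := zero_lt_one.trans_le <| hasSum_le (fun k => by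
    rcases k with _ | k
    · simp [hp0]
    · refine le_mul_of_one_le_left (hpnn _) ?_
      push_cast; linarith [(k.cast_nonneg : (0 : ℝ) ≤ k)]) hp hmean
  have hG1 : ∀ x, mu * ∑' k : ℕ, ((k : ℝ) * p k / mu) * x ^ (k - 1) = pgfDeriv p x := fun x => by
    rw [← tsum_mul_left]
    exact tsum_congr fun k => by field_simp
  obtain ⟨W, hWdef, h⟩ : ∃ W : ℝ → ℝ,
      (∀ t, τ < t → W t = ρ * fρ (t - τ)) ∧ FluidProfile p mu ρ τ W :=
    ⟨_, fun t ht => if_neg ht.not_ge, fluidProfile_of_inverse hp0 hpnn hp hmom2 hmean hmu0 hρmem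
      hρcase.1 hρcase.2 (by rw [← hG1, hρfix]) hτ hfρinv hfρzero⟩
  have hζ0' : ∀ t, 0 ≤ t → ζ 0 t = excess p mu τ W t := fun t ht => by
    rw [hζ0, excess]
    by_cases htτ : t ≤ τ
    · rw [if_pos ⟨ht, htτ⟩, if_pos htτ, ← h.W_of_mem ⟨ht, htτ⟩, h.mu_mul_W_sq ⟨ht, htτ⟩, ← hG1]
      ring
    · rw [if_neg fun hmem => htτ hmem.2, if_neg htτ]
  have hζ' : ∀ k, 1 ≤ k → ∀ t, 0 ≤ t → ζ k t = p k * W t ^ k := fun k hk t ht => by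
    rcases le_or_gt t τ with htτ | htτ
    · have hnn := (sq_nonneg ρ).trans (h.rho_sq_le htτ)
      rw [(hζk k hk t).1 ht htτ, h.W_of_mem ⟨ht, htτ⟩, Real.sqrt_eq_rpow, ← Real.rpow_natCast,
        ← Real.rpow_mul hnn]
      congr 2; ring
    · rw [(hζk k hk t).2 htτ, hWdef t htτ, mul_pow, mul_assoc]
  have hrate : ∀ k s, 0 ≤ s → rcoord (fun j => ζ j s) k = rate p mu τ W k s := fun k s hs =>
    h.rcoord_eq_rate (hζ0' s hs) (fun k hk => hζ' k hk s hs) k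
  have hψ' : ∀ t, 0 ≤ t →
      ψ t = ∑' k : ℕ, ((k : ℝ) - 2) * ∫ x in (0 : ℝ)..t, rate p mu τ W k x := fun t ht => by
    rw [hψ, (h.hasSum_drift ht).summable.tsum_eq_zero_add]
    congr 1
    · rw [intervalIntegral.integral_congr fun s hs => hrate 0 s ?_]
      · simp
      · rw [Set.uIcc_of_le ht] at hs
        exact hs.1
    · refine tsum_congr fun k => ?_
      rw [h.integral_rate (by omega) ht, hζ' _ (by omega) t ht]
      push_cast; ring
  have hCT := h.memCT_of_eq (T := T) hζ0' hζ' hψ'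
  refine ⟨h.tau_pos, hCT, rateI_eq_zero_of_integral hCT h.measurable_rate h.rate_nonneg
    h.rate_le_one hrate (fun k hk t ht => ?_) fun t ht => hψ' t ht.1⟩
  rw [hζ' k hk t ht.1, h.integral_rate hk ht.1]
  ring
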